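/- Let q = p^e with p prime, m ≥ 4 with (m, q) ≠ (4, 2) and 2 | em, and set s = p^{em/2} = √(q^m). Let N be a divisor of q^m − 1 with 1 < N < q^m − 1 such that p^{ℓ1} ≡ −1 (mod N) for some positive integer ℓ1; choose ℓ1 minimal and write em = 2ℓ1·t. Let J ⊊ Z_N with |J| = u, and if q is odd assume additionally N | (q^m − 1)/2 and J + (q^m − 1)/2 ≡ J (mod N). Let D = D_J = ∪_{j∈J} C_j. If J is invariant under the map ρ : j ↦ j + (q^m − 1)/(q − 1) (mod N) and one of the following holds: (1) t is odd, u ≠ sN/(s + 1), and u > N/(s + 1); (2) t is even and u > (q−1)sN/((s + q)(s − 1)), then C(M_D) is a minimal linear code. -/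

import Mathlib

/-- The codeword `c(u,v)` of the code `C(M_D)` for `D` a set. -/
noncomputable def codewordMD (F E : Type*) [Field F] [Field E] [Algebra F E]
    (D : Set E) (w : F × E) : {x : E // x ≠ 0} → F :=
  fun x => w.1 * D.indicator (fun _ => (1 : F)) (x : E) + Algebra.trace F E (w.2 * (x : E))

section TraceCharacter

variable {p : ℕ} [Fact p.Prime] {K : Type*} [Field K] [Algebra (ZMod p) K]

/-- The canonical additive character of a finite field of characteristic `p`. -/
noncomputable def traceChar (p : ℕ) [Fact p.Prime] (K : Type*) [Field K] [Algebra (ZMod p) K] :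
    AddChar K ℂ :=
  (ZMod.stdAddChar (N := p)).compAddMonoidHom (Algebra.trace (ZMod p) K).toAddMonoidHom

theorem traceChar_apply (x : K) :
    traceChar p K x = ZMod.stdAddChar (N := p) (Algebra.trace (ZMod p) K x) := rfl

theorem traceChar_tower {F E : Type*} [Field F] [Field E] [Fintype F] [Fintype E] [Algebra F E]
    [Algebra (ZMod p) F] [Algebra (ZMod p) E] (x : E) :
    traceChar p E x = traceChar p F (Algebra.trace F E x) := by
  rw [traceChar_apply, traceChar_apply, Algebra.trace_trace]

variable [Fintype K]

theorem traceChar_pow_prime (x : K) : traceChar p K (x ^ p) = traceChar p K x := by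
  have : CharP K p := charP_of_injective_algebraMap (algebraMap (ZMod p) K).injective p
  rw [traceChar_apply, traceChar_apply]
  congr 1
  have := Algebra.trace_eq_of_algEquiv (FiniteField.frobeniusAlgEquiv (ZMod p) K p) x
  simpa [FiniteField.frobeniusAlgEquiv_apply, ZMod.card] using this

theorem traceChar_pow_prime_pow (l : ℕ) (x : K) :
    traceChar p K (x ^ p ^ l) = traceChar p K x := by
  induction l with
  | zero => simp
  | succ l ih => rw [pow_succ, pow_mul, traceChar_pow_prime, ih]

open Classical in
theorem sum_traceChar_mul (a : K) :
    ∑ x : K, traceChar p K (a * x) = if a = 0 then (Fintype.card K : ℂ) else 0 := by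
  have : CharP K p := charP_of_injective_algebraMap (algebraMap (ZMod p) K).injective p
  split_ifs with ha
  · simp [ha]
  · obtain ⟨c, hc⟩ := Algebra.trace_surjective (ZMod p) K 1
    have hne : (traceChar p K).mulShift a ≠ 1 := by
      intro h
      have h1 := DFunLike.congr_fun h (a⁻¹ * c)
      rw [AddChar.mulShift_apply, mul_inv_cancel_left₀ ha, traceChar_apply, hc,
        AddChar.one_apply, ← AddChar.map_zero_eq_one (ZMod.stdAddChar (N := p))] at h1
      exact one_ne_zero (ZMod.injective_stdAddChar h1)
    simpa [AddChar.mulShift_apply] using AddChar.sum_eq_zero_of_ne_one hne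

end TraceCharacter

section PowerFibres

variable {E : Type*} [Field E] [Fintype E]

open Classical in
theorem card_filter_pow_eq {n : ℕ} (hn : 0 < n) {ζ : E} (hζ : IsPrimitiveRoot ζ n) {x : E}
    (hx : x ≠ 0) : (Finset.univ.filter fun y : E => y ≠ 0 ∧ y ^ n = x ^ n).card = n := by
  have h := hζ.card_nthRoots (x ^ n)
  rw [if_pos ⟨x, rfl⟩,
    ← Multiset.toFinset_card_of_nodup (hζ.nthRoots_nodup (pow_ne_zero n hx))] at h
  refine Eq.trans (congrArg _ ?_) h
  ext y
  simp only [Finset.mem_filter, Finset.mem_univ, true_and, Multiset.mem_toFinset,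
    Polynomial.mem_nthRoots hn, and_iff_right_iff_imp]
  rintro hy rfl
  rw [zero_pow hn.ne'] at hy
  exact pow_ne_zero n hx hy.symm

open Classical in
/-- A set of nonzero elements determined by `n`-th powers consists of full fibres of size `n`. -/
theorem card_filter_pow {n : ℕ} (hn : 0 < n) {ζ : E} (hζ : IsPrimitiveRoot ζ n) (P : E → Prop) :
    (Finset.univ.filter fun x : E => x ≠ 0 ∧ P (x ^ n)).card =
      (Finset.image (fun x : E => x ^ n)
        (Finset.univ.filter fun x : E => x ≠ 0 ∧ P (x ^ n))).card * n := by
  rw [Finset.card_eq_sum_card_fiberwise (f := fun x : E => x ^ n)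
    (t := Finset.image (fun x : E => x ^ n)
      (Finset.univ.filter fun x : E => x ≠ 0 ∧ P (x ^ n)))
    fun x hx => Finset.mem_coe.2 (Finset.mem_image_of_mem _ hx)]
  refine Finset.sum_const_nat fun b hb => ?_
  obtain ⟨x, hx, rfl⟩ := Finset.mem_image.1 hb
  simp only [Finset.mem_filter, Finset.mem_univ, true_and] at hx
  refine Eq.trans (congrArg _ ?_) (card_filter_pow_eq hn hζ hx.1)
  ext y
  simp only [Finset.mem_filter, Finset.mem_univ, true_and]
  exact ⟨fun hy => ⟨hy.1.1, hy.2⟩, fun hy => ⟨⟨hy.1, hy.2 ▸ hx.2⟩, hy.2⟩⟩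

open Classical in
theorem card_filter_ne_zero :
    (Finset.univ.filter fun x : E => x ≠ 0).card = Fintype.card E - 1 := by
  rw [Finset.filter_ne' Finset.univ (0 : E), Finset.card_erase_of_mem (Finset.mem_univ _),
    Finset.card_univ]

open Classical in
theorem card_image_pow_mul {n : ℕ} (hn : 0 < n) {ζ : E} (hζ : IsPrimitiveRoot ζ n) :
    (Finset.image (fun x : E => x ^ n) (Finset.univ.filter fun x : E => x ≠ 0)).card * n =
      Fintype.card E - 1 := by
  rw [← card_filter_ne_zero]
  simpa using (card_filter_pow hn hζ fun _ => True).symm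

end PowerFibres

section Generator

theorem sq_sub_one_dvd (r t : ℕ) : (r + 1) * (r - 1) ∣ (r ^ 2) ^ t - 1 := by
  have h : (r + 1) * (r - 1) = r ^ 2 - 1 := by
    rw [← Nat.sq_sub_sq, one_pow]
  rw [h]
  simpa using Nat.sub_dvd_pow_sub_pow (r ^ 2) 1 t

variable {E : Type*} [Field E] [Fintype E] {r t : ℕ} {γ : E}

theorem exists_nat_pow_eq (hγ : IsPrimitiveRoot γ (Fintype.card E - 1)) {x : E} (hx : x ≠ 0) :
    ∃ k < Fintype.card E - 1, γ ^ k = x := by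
  have : NeZero (Fintype.card E - 1) := ⟨by have := Fintype.one_lt_card (α := E); omega⟩
  exact hγ.eq_pow_of_pow_eq_one (FiniteField.pow_card_sub_one_eq_one x hx)

theorem exists_primitiveRoot_of_dvd (hγ : IsPrimitiveRoot γ (Fintype.card E - 1)) {n : ℕ}
    (hn : n ∣ Fintype.card E - 1) : ∃ ζ : E, IsPrimitiveRoot ζ n := by
  obtain ⟨d, hd⟩ := hn
  refine ⟨γ ^ d, hγ.pow ?_ (hd.trans (mul_comm _ _))⟩
  have := Fintype.one_lt_card (α := E)
  omega

/-- Elements of the subfield with `r` elements are `(r + 1)`-th powers (norms). -/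
theorem exists_pow_succ_eq (hr : 2 ≤ r) (hE : Fintype.card E = (r ^ 2) ^ t)
    (hγ : IsPrimitiveRoot γ (Fintype.card E - 1)) {c : E} (hc : c ^ (r - 1) = 1) :
    ∃ y : E, y ≠ 0 ∧ y ^ (r + 1) = c := by
  have hc0 : c ≠ 0 := by
    rintro rfl
    rw [zero_pow (by omega)] at hc
    exact zero_ne_one hc
  obtain ⟨k, -, rfl⟩ := exists_nat_pow_eq hγ hc0
  rw [← pow_mul] at hc
  have hd := (hE ▸ sq_sub_one_dvd r t).trans ((hγ.pow_eq_one_iff_dvd _).1 hc)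
  obtain ⟨j, rfl⟩ := Nat.dvd_of_mul_dvd_mul_right (by omega) hd
  have hγ0 : γ ≠ 0 := hγ.ne_zero (Nat.sub_pos_of_lt Fintype.one_lt_card).ne'
  exact ⟨γ ^ j, pow_ne_zero _ hγ0, by rw [← pow_mul, mul_comm]⟩

/-- There is `θ` in the subfield with `r ^ 2` elements whose trace to the subfield with `r`
elements is `1`. -/
theorem exists_add_pow_eq_one {p l : ℕ} [Fact p.Prime] [CharP E p] (hrp : r = p ^ l) (hr : 2 ≤ r)
    (hE : Fintype.card E = (r ^ 2) ^ t) (hγ : IsPrimitiveRoot γ (Fintype.card E - 1)) :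
    ∃ θ : E, θ + θ ^ r = 1 := by
  obtain ⟨g, hg⟩ := exists_primitiveRoot_of_dvd hγ (hE ▸ sq_sub_one_dvd r t)
  have hsq : (r + 1) * (r - 1) + 1 = r * r := by
    obtain ⟨d, rfl⟩ := Nat.exists_eq_add_of_le' hr
    simp only [show d + 2 - 1 = d + 1 by omega]
    ring
  have hgr : (g ^ r) ^ r = g := by
    rw [← pow_mul, ← hsq, pow_succ, hg.pow_eq_one, one_mul]
  have hg0 : g ≠ 0 := by
    rintro rfl
    have h := hg.pow_eq_one
    rw [zero_pow (Nat.mul_ne_zero (by omega) (by omega))] at h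
    exact zero_ne_one h
  have hc : g + g ^ r ≠ 0 := by
    intro h
    have h1 : g ^ (r - 1) = -1 := by
      refine mul_left_cancel₀ hg0 ?_
      rw [← pow_succ', show r - 1 + 1 = r by omega, mul_neg_one]
      exact eq_neg_of_add_eq_zero_right h
    have h2 : g ^ (2 * (r - 1)) = 1 := by
      rw [mul_comm, pow_mul, h1]; norm_num
    have h3 := Nat.dvd_of_mul_dvd_mul_right (by omega) ((hg.pow_eq_one_iff_dvd _).1 h2)
    have := Nat.le_of_dvd (by norm_num) h3
    omega
  refine ⟨g / (g + g ^ r), ?_⟩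
  have hcr : (g + g ^ r) ^ r = g + g ^ r := by
    conv_lhs => rw [hrp, add_pow_char_pow, ← hrp]
    rw [hgr, add_comm]
  rw [div_pow, hcr, ← add_div, div_self hc]

end Generator

section HermitianSum

variable {p l r t : ℕ} [Fact p.Prime] {E : Type*} [Field E] [Fintype E] [Algebra (ZMod p) E]
  {γ : E}

/-- The exponential sum of the Hermitian form `y ↦ a * y ^ (r + 1)`. -/
noncomputable def hermitianSum (p r : ℕ) [Fact p.Prime] {E : Type*} [Field E] [Fintype E]
    [Algebra (ZMod p) E] (a : E) : ℂ :=
  ∑ y : E, traceChar p E (a * y ^ (r + 1))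

open Classical in
theorem card_trace_eq_const (hl : 0 < l) (hrp : r = p ^ l) (hE : Fintype.card E = (r ^ 2) ^ t)
    (hγ : IsPrimitiveRoot γ (Fintype.card E - 1)) (a : E) {c : ZMod p} (hc : c ≠ 0) :
    (Finset.univ.filter fun y : E => Algebra.trace (ZMod p) E (a * y ^ (r + 1)) = c).card =
      (Finset.univ.filter fun y : E => Algebra.trace (ZMod p) E (a * y ^ (r + 1)) = 1).card := by
  have hp : 2 ≤ p := (Fact.out : p.Prime).two_le
  have hr : 2 ≤ r := hrp ▸ hp.trans (Nat.le_self_pow hl.ne' p)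
  have hc1 : (algebraMap (ZMod p) E c) ^ (r - 1) = 1 := by
    have hd : p - 1 ∣ r - 1 := by
      rw [hrp]; simpa using Nat.sub_dvd_pow_sub_pow p 1 l
    obtain ⟨d, hd⟩ := hd
    rw [hd, ← map_pow, pow_mul, ZMod.pow_card_sub_one_eq_one hc, one_pow, map_one]
  obtain ⟨z, hz, hzc⟩ := exists_pow_succ_eq hr hE hγ hc1
  symm
  refine Finset.card_equiv (Equiv.mulLeft₀ z hz) fun y => ?_
  have h : a * (z * y) ^ (r + 1) = c • (a * y ^ (r + 1)) := by
    rw [mul_pow, hzc, Algebra.smul_def]; ring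
  simp only [Finset.mem_filter, Finset.mem_univ, true_and, Equiv.mulLeft₀_apply, h, map_smul,
    smul_eq_mul]
  exact ⟨fun hy => by rw [hy, mul_one], fun hy => mul_left_cancel₀ hc (hy.trans (mul_one c).symm)⟩

theorem hermitianSum_eq_int (hl : 0 < l) (hrp : r = p ^ l) (hE : Fintype.card E = (r ^ 2) ^ t)
    (hγ : IsPrimitiveRoot γ (Fintype.card E - 1)) (a : E) :
    ∃ z : ℤ, hermitianSum p r a = z ∧ (r + 1 : ℤ) ∣ z - 1 := by
  classical
  have hp : 2 ≤ p := (Fact.out : p.Prime).two_le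
  have hr : 2 ≤ r := hrp ▸ hp.trans (Nat.le_self_pow hl.ne' p)
  obtain ⟨ζ, hζ⟩ := exists_primitiveRoot_of_dvd hγ
    (hE ▸ (Dvd.intro _ rfl).trans (sq_sub_one_dvd r t) : r + 1 ∣ Fintype.card E - 1)
  set n : ZMod p → ℕ := fun c =>
    (Finset.univ.filter fun y : E => Algebra.trace (ZMod p) E (a * y ^ (r + 1)) = c).card with hn
  have hdvd : ∀ c : ZMod p, r + 1 ∣ (Finset.univ.filter fun y : E =>
      y ≠ 0 ∧ Algebra.trace (ZMod p) E (a * y ^ (r + 1)) = c).card := fun c => by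
    refine ⟨_, Eq.trans ?_ ((card_filter_pow r.succ_pos hζ
      fun b => Algebra.trace (ZMod p) E (a * b) = c).trans (mul_comm _ _))⟩
    convert rfl
  have h1 : r + 1 ∣ n 1 := by
    refine (hdvd 1).trans (dvd_of_eq (congrArg _ (Finset.filter_congr fun y _ => ?_)))
    refine and_iff_right_of_imp ?_
    rintro hy rfl
    simp at hy
  have h0 : ∃ d, n 0 = (r + 1) * d + 1 := by
    obtain ⟨d, hd⟩ := hdvd 0
    refine ⟨d, ?_⟩
    rw [← hd]
    have hins : (Finset.univ.filter fun y : E => Algebra.trace (ZMod p) E (a * y ^ (r + 1)) = 0) =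
        insert 0 (Finset.univ.filter fun y : E =>
          y ≠ 0 ∧ Algebra.trace (ZMod p) E (a * y ^ (r + 1)) = 0) := by
      ext y
      by_cases hy : y = 0 <;> simp [hy]
    simp only [hn, hins]
    rw [Finset.card_insert_of_notMem (by simp)]
  obtain ⟨d1, h1⟩ := h1
  obtain ⟨d0, h0⟩ := h0
  refine ⟨n 0 - n 1, ?_, ⟨d0 - d1, ?_⟩⟩
  · have hsum : ∑ c : ZMod p, ZMod.stdAddChar (N := p) c = 0 := by
      refine AddChar.sum_eq_zero_of_ne_one fun h => ?_
      have h2 := DFunLike.congr_fun h 1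
      rw [AddChar.one_apply, ← AddChar.map_zero_eq_one (ZMod.stdAddChar (N := p))] at h2
      exact one_ne_zero (ZMod.injective_stdAddChar h2)
    have hfib : hermitianSum p r a = ∑ c : ZMod p, (n c : ℂ) * ZMod.stdAddChar (N := p) c := by
      rw [hermitianSum, ← Finset.sum_fiberwise Finset.univ
        fun y : E => Algebra.trace (ZMod p) E (a * y ^ (r + 1))]
      refine Finset.sum_congr rfl fun c _ => ?_
      rw [← nsmul_eq_mul]
      refine Finset.sum_eq_card_nsmul fun y hy => ?_
      rw [traceChar_apply, (Finset.mem_filter.1 hy).2]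
    have hnc : ∀ c : ZMod p, (n c : ℂ) = n 1 + if c = 0 then (n 0 - n 1 : ℂ) else 0 := by
      intro c
      split_ifs with hc
      · rw [hc]; ring
      · rw [add_zero]
        exact congrArg _ (card_trace_eq_const hl hrp hE hγ a hc)
    rw [hfib, Finset.sum_congr rfl fun c _ => congrArg (· * ZMod.stdAddChar (N := p) c) (hnc c)]
    simp only [add_mul, Finset.sum_add_distrib]
    rw [← Finset.mul_sum, hsum, mul_zero, zero_add,
      Finset.sum_eq_single_of_mem 0 (Finset.mem_univ _) fun c _ hc => by rw [if_neg hc, zero_mul],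
      if_pos rfl, AddChar.map_zero_eq_one, mul_one]
    push_cast
    rfl
  · rw [h0, h1]; push_cast; ring

theorem sum_pow_prime_pow (hrp : r = p ^ l) (f : E → ℂ) : ∑ y : E, f (y ^ r) = ∑ y : E, f y := by
  have : CharP E p := charP_of_injective_algebraMap (algebraMap (ZMod p) E).injective p
  have := (iterateFrobeniusEquiv E p l).toEquiv.sum_comp f
  simpa [iterateFrobenius_def, hrp] using this

open Classical in
/-- The radical of the Hermitian form `y ↦ a * y ^ (r + 1)`. -/
noncomputable def hermitianRadical (r : ℕ) {E : Type*} [Field E] [Fintype E] (a : E) : Finset E :=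
  Finset.univ.filter fun x : E => a ^ r * x ^ (r * r) + a * x = 0

theorem mem_hermitianRadical {a x : E} :
    x ∈ hermitianRadical r a ↔ a ^ r * x ^ (r * r) + a * x = 0 := by
  simp [hermitianRadical]

theorem traceChar_eq_one_of_mem_radical (hl : 0 < l) (hrp : r = p ^ l)
    (hE : Fintype.card E = (r ^ 2) ^ t)
    (hγ : IsPrimitiveRoot γ (Fintype.card E - 1)) {a x : E} (hx : x ∈ hermitianRadical r a) :
    traceChar p E (a * x ^ (r + 1)) = 1 := by
  have : CharP E p := charP_of_injective_algebraMap (algebraMap (ZMod p) E).injective p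
  have hp : 2 ≤ p := (Fact.out : p.Prime).two_le
  have hr : 2 ≤ r := hrp ▸ hp.trans (Nat.le_self_pow hl.ne' p)
  obtain ⟨θ, hθ⟩ := exists_add_pow_eq_one hrp hr hE hγ
  rw [mem_hermitianRadical] at hx
  have hz : (a * x ^ (r + 1)) ^ r = -(a * x ^ (r + 1)) := by
    have : (a * x ^ (r + 1)) ^ r = (a ^ r * x ^ (r * r)) * x ^ r := by
      rw [mul_pow, ← pow_mul]; ring
    rw [this, eq_neg_of_add_eq_zero_left hx]; ring
  have h : a * x ^ (r + 1) = a * x ^ (r + 1) * θ + -(a * x ^ (r + 1) * θ) ^ r := by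
    rw [mul_pow, hz]
    linear_combination -(a * x ^ (r + 1)) * hθ
  rw [h, AddChar.map_add_eq_mul, AddChar.map_neg_eq_inv]
  conv_lhs => rw [hrp, traceChar_pow_prime_pow, ← hrp]
  refine mul_inv_cancel₀ fun h0 => ?_
  have := AddChar.map_add_eq_mul (traceChar p E) (a * x ^ (r + 1) * θ) (-(a * x ^ (r + 1) * θ))
  rw [h0, add_neg_cancel, AddChar.map_zero_eq_one, zero_mul] at this
  exact one_ne_zero this

theorem card_radical (hr : 2 ≤ r) (hE : Fintype.card E = (r ^ 2) ^ t)
    (hγ : IsPrimitiveRoot γ (Fintype.card E - 1)) {a : E} (ha : a ≠ 0) :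
    (hermitianRadical r a).card = 1 ∨
      ((hermitianRadical r a).card = r * r ∧ ∃ x ≠ 0, x ∈ hermitianRadical r a) := by
  classical
  obtain ⟨g, hg⟩ := exists_primitiveRoot_of_dvd hγ (hE ▸ sq_sub_one_dvd r t)
  have hsq : (r + 1) * (r - 1) + 1 = r * r := by
    obtain ⟨d, rfl⟩ := Nat.exists_eq_add_of_le' hr
    simp only [show d + 2 - 1 = d + 1 by omega]
    ring
  have h0 : (0 : E) ∈ hermitianRadical r a := by
    rw [mem_hermitianRadical, zero_pow (Nat.mul_ne_zero (by omega) (by omega))]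
    ring
  by_cases h : ∃ x ≠ 0, x ∈ hermitianRadical r a
  · refine Or.inr ⟨?_, h⟩
    obtain ⟨x, hx, hxm⟩ := h
    have hpos : 0 < (r + 1) * (r - 1) := Nat.mul_pos (by omega) (by omega)
    rw [← hsq, ← card_filter_pow_eq hpos hg hx]
    rw [← Finset.card_insert_of_notMem (a := (0 : E)) (by simp)]
    congr 1
    ext y
    rw [mem_hermitianRadical, ← hsq, pow_succ] at hxm
    by_cases hy : y = 0
    · simp [hy, h0]
    · simp only [Finset.mem_insert, hy, false_or, Finset.mem_filter, Finset.mem_univ, true_and,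
        mem_hermitianRadical, ← hsq, pow_succ (n := (r + 1) * (r - 1)), ne_eq, not_false_eq_true]
      have hxm' : a ^ r * x ^ ((r + 1) * (r - 1)) + a = 0 :=
        mul_right_cancel₀ hx (by linear_combination hxm)
      refine ⟨fun hym => ?_, fun hym => by rw [hym]; linear_combination y * hxm'⟩
      have hym' : a ^ r * y ^ ((r + 1) * (r - 1)) + a = 0 :=
        mul_right_cancel₀ hy (by linear_combination hym)
      exact mul_left_cancel₀ (pow_ne_zero r ha) (by linear_combination hym' - hxm')
  · left
    rw [Finset.card_eq_one]
    refine ⟨0, Finset.eq_singleton_iff_unique_mem.2 ⟨h0, fun x hx => ?_⟩⟩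
    by_contra hx0
    exact h ⟨x, hx0, hx⟩

theorem hermitianSum_mul_neg (hrp : r = p ^ l) (a : E) :
    hermitianSum p r a * hermitianSum p r (-a) =
      Fintype.card E * ∑ x ∈ hermitianRadical r a, traceChar p E (a * x ^ (r + 1)) := by
  classical
  have : CharP E p := charP_of_injective_algebraMap (algebraMap (ZMod p) E).injective p
  have hterm : ∀ x y : E, traceChar p E (a * (x + y) ^ (r + 1)) * traceChar p E (-a * y ^ (r + 1)) =
      traceChar p E (a * x ^ (r + 1)) *
        traceChar p E ((a ^ r * x ^ (r * r) + a * x) * y ^ r) := by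
    intro x y
    have h1 : traceChar p E (a ^ r * x ^ (r * r) * y ^ r) = traceChar p E (a * x ^ r * y) := by
      have : a ^ r * x ^ (r * r) * y ^ r = (a * x ^ r * y) ^ p ^ l := by
        rw [← hrp, mul_pow, mul_pow, pow_mul]
      rw [this, traceChar_pow_prime_pow]
    rw [add_mul, AddChar.map_add_eq_mul, h1, ← AddChar.map_add_eq_mul, ← AddChar.map_add_eq_mul,
      ← AddChar.map_add_eq_mul]
    congr 1
    have h2 : (x + y) ^ r = x ^ r + y ^ r := by rw [hrp, add_pow_char_pow]
    rw [pow_succ, h2]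
    ring
  calc hermitianSum p r a * hermitianSum p r (-a)
      = ∑ y : E, ∑ x : E,
          traceChar p E (a * (x + y) ^ (r + 1)) * traceChar p E (-a * y ^ (r + 1)) := by
        rw [hermitianSum, hermitianSum, Finset.mul_sum]
        refine Finset.sum_congr rfl fun y _ => ?_
        rw [← Finset.sum_mul]
        congr 1
        exact (Equiv.sum_comp (Equiv.addRight y) fun x => traceChar p E (a * x ^ (r + 1))).symm
    _ = ∑ x : E, traceChar p E (a * x ^ (r + 1)) *
          ∑ y : E, traceChar p E ((a ^ r * x ^ (r * r) + a * x) * y) := by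
        rw [Finset.sum_comm]
        refine Finset.sum_congr rfl fun x _ => ?_
        simp_rw [hterm]
        rw [← Finset.mul_sum]
        congr 1
        exact sum_pow_prime_pow hrp fun y => traceChar p E ((a ^ r * x ^ (r * r) + a * x) * y)
    _ = _ := by
        simp_rw [sum_traceChar_mul]
        rw [hermitianRadical, Finset.sum_filter, Finset.mul_sum]
        refine Finset.sum_congr rfl fun x _ => ?_
        split_ifs <;> ring

theorem hermitianSum_mul_pow {c : E} (hc : c ≠ 0) (a : E) :
    hermitianSum p r (a * c ^ (r + 1)) = hermitianSum p r a := by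
  rw [hermitianSum, hermitianSum]
  refine Eq.trans ?_ (Equiv.sum_comp (Equiv.mulLeft₀ c hc) fun y => traceChar p E (a * y ^ (r + 1)))
  refine Finset.sum_congr rfl fun y _ => ?_
  rw [Equiv.mulLeft₀_apply, mul_pow, mul_assoc]

theorem neg_one_pow_pred (hrp : r = p ^ l) (hr : 2 ≤ r) : ((-1 : ZMod p)) ^ (r - 1) = 1 := by
  have h : ((-1 : ZMod p)) ^ r = -1 := by rw [hrp, ZMod.pow_card_pow]
  have h2 : ((-1 : ZMod p)) ^ (r - 1 + 1) = -1 := by rwa [show r - 1 + 1 = r by omega]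
  rw [pow_succ, mul_neg_one, neg_inj] at h2
  exact h2

theorem hermitianSum_neg (hrp : r = p ^ l) (hr : 2 ≤ r) (hE : Fintype.card E = (r ^ 2) ^ t)
    (hγ : IsPrimitiveRoot γ (Fintype.card E - 1)) (a : E) :
    hermitianSum p r (-a) = hermitianSum p r a := by
  have h : ((-1 : E)) ^ (r - 1) = 1 := by
    have := congrArg (algebraMap (ZMod p) E) (neg_one_pow_pred hrp hr)
    simpa using this
  obtain ⟨c, hc, hc1⟩ := exists_pow_succ_eq hr hE hγ h
  rw [← hermitianSum_mul_pow hc a, hc1, mul_neg_one]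

theorem hermitianSum_sq (hl : 0 < l) (hrp : r = p ^ l) (hE : Fintype.card E = (r ^ 2) ^ t)
    (hγ : IsPrimitiveRoot γ (Fintype.card E - 1)) (a : E) :
    hermitianSum p r a ^ 2 = Fintype.card E * (hermitianRadical r a).card := by
  have hr : 2 ≤ r := hrp ▸ (Fact.out : p.Prime).two_le.trans (Nat.le_self_pow hl.ne' p)
  have h := hermitianSum_mul_neg hrp a
  rw [hermitianSum_neg hrp hr hE hγ, Finset.sum_congr rfl fun x hx =>
    traceChar_eq_one_of_mem_radical hl hrp hE hγ hx] at h
  rw [sq, h]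
  simp

/-- The exponential sum of the Hermitian form takes only two values. -/
theorem hermitianSum_eq (hl : 0 < l) (hrp : r = p ^ l) (hE : Fintype.card E = (r ^ 2) ^ t)
    (hγ : IsPrimitiveRoot γ (Fintype.card E - 1)) {a : E} (ha : a ≠ 0) :
    hermitianSum p r a = (-1) ^ t * r ^ t ∨
      (hermitianSum p r a = -((-1) ^ t * r ^ t * r) ∧ ∃ x ≠ 0, x ∈ hermitianRadical r a) := by
  have hr : 2 ≤ r := hrp ▸ (Fact.out : p.Prime).two_le.trans (Nat.le_self_pow hl.ne' p)
  obtain ⟨z, hz, hdvd⟩ := hermitianSum_eq_int (p := p) hl hrp hE hγ a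
  have hsq := hermitianSum_sq hl hrp hE hγ a
  have hone : (r + 1 : ℤ) ∣ (-1) ^ t * r ^ t - 1 := by
    rw [← mul_pow]
    refine (Dvd.intro (-1) ?_ : (r + 1 : ℤ) ∣ (-1 * r) - 1).trans (sub_one_dvd_pow_sub_one _ t)
    ring
  have hnot : ¬ (r + 1 : ℤ) ∣ 2 := fun h => by
    have := Int.le_of_dvd (by norm_num) h
    omega
  have hee : ((-1 : ℤ) ^ t) * (-1) ^ t = 1 := by rw [← mul_pow]; norm_num
  have hE' : (Fintype.card E : ℤ) = ((-1) ^ t * r ^ t) ^ 2 := by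
    rw [hE, mul_pow, sq ((-1 : ℤ) ^ t), hee, one_mul]
    push_cast; ring
  rw [hz] at hsq ⊢
  have hsq' : z ^ 2 = Fintype.card E * (hermitianRadical r a).card := by exact_mod_cast hsq
  rw [hE'] at hsq'
  obtain hcard | ⟨hcard, hx⟩ := card_radical hr hE hγ ha
  · left
    rw [hcard, Nat.cast_one, mul_one, sq_eq_sq_iff_eq_or_eq_neg] at hsq'
    obtain h | h := hsq'
    · exact_mod_cast congrArg (Int.cast : ℤ → ℂ) h
    · refine absurd ?_ hnot
      have := dvd_add hdvd hone
      rw [h] at this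
      rw [← dvd_neg]
      convert this using 1; ring
  · right
    refine ⟨?_, hx⟩
    rw [hcard, Nat.cast_mul, ← sq (r : ℤ), ← mul_pow, sq_eq_sq_iff_eq_or_eq_neg] at hsq'
    obtain h | h := hsq'
    · refine absurd ?_ hnot
      have := dvd_sub (dvd_add hdvd hone) (Dvd.intro_left ((-1) ^ t * (r : ℤ) ^ t) rfl)
      rw [h] at this
      rw [← dvd_neg]
      convert this using 1; ring
    · exact_mod_cast congrArg (Int.cast : ℤ → ℂ) h

end HermitianSum

section CharacterValues

variable {p l r t : ℕ} [Fact p.Prime] {E : Type*} [Field E] [Fintype E] [Algebra (ZMod p) E]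
  {γ : E}

theorem pow_mul_pow_eq_neg_one (hr : 2 ≤ r) {a x : E} (ha : a ≠ 0) (hx : x ≠ 0)
    (h : x ∈ hermitianRadical r a) : (a * x ^ (r + 1)) ^ (r - 1) = -1 := by
  rw [mem_hermitianRadical] at h
  obtain ⟨d, rfl⟩ := Nat.exists_eq_add_of_le' hr
  refine mul_right_cancel₀ (mul_ne_zero ha hx) ?_
  rw [show d + 2 - 1 = d + 1 by omega]
  have : a ^ (d + 2) * x ^ ((d + 2) * (d + 2)) = (a * x ^ (d + 2 + 1)) ^ (d + 1) * (a * x) := by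
    ring
  rw [← this, neg_one_mul]
  exact eq_neg_of_add_eq_zero_left h

theorem exists_eq_mul_pow_of_radical (hr : 2 ≤ r) (hE : Fintype.card E = (r ^ 2) ^ t)
    (hγ : IsPrimitiveRoot γ (Fintype.card E - 1)) {a b x z : E} (ha : a ≠ 0) (hb : b ≠ 0)
    (hx : x ≠ 0) (hz : z ≠ 0) (hxa : x ∈ hermitianRadical r a) (hzb : z ∈ hermitianRadical r b) :
    ∃ y : E, y ≠ 0 ∧ b = a * y ^ (r + 1) := by
  have hc : ((b * z ^ (r + 1)) / (a * x ^ (r + 1))) ^ (r - 1) = 1 := by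
    rw [div_pow, pow_mul_pow_eq_neg_one hr ha hx hxa, pow_mul_pow_eq_neg_one hr hb hz hzb,
      div_self (neg_ne_zero.2 one_ne_zero)]
  obtain ⟨y, hy, hyc⟩ := exists_pow_succ_eq hr hE hγ hc
  refine ⟨y * x / z, div_ne_zero (mul_ne_zero hy hx) hz, ?_⟩
  rw [div_pow, mul_pow, hyc]
  field_simp

/-- The nontrivial character values of a union of cosets of the `(r + 1)`-th powers. -/
theorem sum_traceChar_eq (hl : 0 < l) (hrp : r = p ^ l) (hE : Fintype.card E = (r ^ 2) ^ t)
    (hγ : IsPrimitiveRoot γ (Fintype.card E - 1)) {D : Finset E} (hD0 : (0 : E) ∉ D)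
    (hD : ∀ x ∈ D, ∀ y : E, y ≠ 0 → x * y ^ (r + 1) ∈ D) {v : E} (hv : v ≠ 0) :
    ∃ δ : ℕ, δ ≤ 1 ∧ ((Fintype.card E - 1 : ℕ) : ℂ) * ∑ x ∈ D, traceChar p E (v * x) =
      D.card * ((-1) ^ t * r ^ t - 1) -
        ((Fintype.card E - 1 : ℕ) : ℂ) * ((-1) ^ t * r ^ t) * δ := by
  classical
  have hr : 2 ≤ r := hrp ▸ (Fact.out : p.Prime).two_le.trans (Nat.le_self_pow hl.ne' p)
  obtain ⟨ζ, hζ⟩ := exists_primitiveRoot_of_dvd hγ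
    (hE ▸ (Dvd.intro _ rfl).trans (sq_sub_one_dvd r t) : r + 1 ∣ Fintype.card E - 1)
  have hvx : ∀ x ∈ D, v * x ≠ 0 := fun x hx => mul_ne_zero hv fun h => hD0 (h ▸ hx)
  set B := D.filter fun x => hermitianSum p r (v * x) ≠ (-1) ^ t * r ^ t with hB
  have hBS : ∀ x ∈ B, hermitianSum p r (v * x) = -((-1) ^ t * r ^ t * r) ∧
      ∃ z ≠ 0, z ∈ hermitianRadical r (v * x) := fun x hx => by
    rw [hB, Finset.mem_filter] at hx
    exact (hermitianSum_eq hl hrp hE hγ (hvx x hx.1)).resolve_left hx.2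
  have hsum : ((Fintype.card E - 1 : ℕ) : ℂ) * ∑ x ∈ D, traceChar p E (v * x) =
      D.card * ((-1) ^ t * r ^ t - 1) - B.card * ((-1) ^ t * r ^ t * (r + 1)) := by
    calc ((Fintype.card E - 1 : ℕ) : ℂ) * ∑ x ∈ D, traceChar p E (v * x)
        = ∑ y ∈ Finset.univ.filter (fun y : E => y ≠ 0),
            ∑ x ∈ D, traceChar p E (v * x * y ^ (r + 1)) := by
          rw [← card_filter_ne_zero, ← nsmul_eq_mul]
          symm
          refine Finset.sum_eq_card_nsmul fun y hy => ?_
          have hy0 : y ≠ 0 := (Finset.mem_filter.1 hy).2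
          refine Finset.sum_nbij' (fun x => x * y ^ (r + 1)) (fun x => x * y⁻¹ ^ (r + 1))
            (fun x hx => hD x hx y hy0) (fun x hx => hD x hx _ (inv_ne_zero hy0))
            (fun x _ => ?_) (fun x _ => ?_) (fun x _ => by rw [mul_assoc])
          all_goals
            rw [mul_assoc, ← mul_pow]
            simp [hy0]
      _ = ∑ x ∈ D, (hermitianSum p r (v * x) - 1) := by
          rw [Finset.sum_comm]
          refine Finset.sum_congr rfl fun x _ => ?_
          rw [hermitianSum, Finset.filter_ne' Finset.univ (0 : E), eq_sub_iff_add_eq,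
            ← Finset.sum_erase_add _ _ (Finset.mem_univ (0 : E))]
          simp
      _ = ∑ x ∈ D, (((-1) ^ t * r ^ t - 1) -
            if hermitianSum p r (v * x) ≠ (-1) ^ t * r ^ t
              then ((-1) ^ t * r ^ t * (r + 1) : ℂ) else 0) := by
          refine Finset.sum_congr rfl fun x hx => ?_
          split_ifs with h
          · rw [(hBS x (Finset.mem_filter.2 ⟨hx, h⟩)).1]; ring
          · rw [not_not.1 h]; ring
      _ = _ := by
          rw [Finset.sum_sub_distrib, ← Finset.sum_filter, Finset.sum_const, Finset.sum_const,
            nsmul_eq_mul, nsmul_eq_mul]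
  rcases B.eq_empty_or_nonempty with hemp | ⟨x₁, hx₁⟩
  · refine ⟨0, Nat.zero_le _, ?_⟩
    rw [hsum, hemp]; simp
  · refine ⟨1, le_rfl, ?_⟩
    have hx₁D : x₁ ∈ D := Finset.filter_subset _ _ hx₁
    have hx₁0 : x₁ ≠ 0 := fun h => hD0 (h ▸ hx₁D)
    have hBim : B = Finset.image (fun b => x₁ * b)
        (Finset.image (fun y : E => y ^ (r + 1)) (Finset.univ.filter fun y : E => y ≠ 0)) := by
      ext x
      simp only [Finset.mem_image, Finset.mem_filter, Finset.mem_univ, true_and,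
        exists_exists_and_eq_and]
      constructor
      · intro hx
        obtain ⟨z₁, hz₁, hzr₁⟩ := (hBS x₁ hx₁).2
        obtain ⟨z, hz, hzr⟩ := (hBS x hx).2
        obtain ⟨y, hy, hyx⟩ := exists_eq_mul_pow_of_radical hr hE hγ (hvx x₁ hx₁D)
          (hvx x (Finset.filter_subset _ _ hx)) hz₁ hz hzr₁ hzr
        exact ⟨y, hy, (mul_left_cancel₀ hv (by rw [hyx, mul_assoc])).symm⟩
      · rintro ⟨y, hy, rfl⟩
        rw [hB, Finset.mem_filter] at hx₁ ⊢
        refine ⟨hD x₁ hx₁.1 y hy, ?_⟩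
        rw [← mul_assoc, hermitianSum_mul_pow hy]
        exact hx₁.2
    have hBc : B.card * (r + 1) = Fintype.card E - 1 := by
      rw [hBim, Finset.card_image_of_injective _ (mul_right_injective₀ hx₁0)]
      exact card_image_pow_mul r.succ_pos hζ
    rw [hsum, ← hBc]
    push_cast
    ring

end CharacterValues

section Hyperplanes

variable {p : ℕ} [Fact p.Prime] {F E : Type*} [Field F] [Field E] [Fintype F] [Fintype E]
  [Algebra F E] [Algebra (ZMod p) F] [Algebra (ZMod p) E]

open Classical in
/-- Summing over a trace hyperplane by orthogonality. -/
theorem card_mul_sum_hyperplane (v : E) (A : Finset E) (g : E → ℂ) :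
    Fintype.card F * ∑ x ∈ A.filter (fun x => Algebra.trace F E (v * x) = 0), g x =
      ∑ y : F, ∑ x ∈ A, traceChar p E (y • v * x) * g x := by
  rw [Finset.sum_comm, Finset.sum_filter, Finset.mul_sum]
  refine Finset.sum_congr rfl fun x _ => ?_
  have h : ∀ y : F, traceChar p E (y • v * x) =
      traceChar p F (Algebra.trace F E (v * x) * y) := fun y => by
    rw [traceChar_tower (F := F), smul_mul_assoc, map_smul, smul_eq_mul, mul_comm]
  simp_rw [h]
  rw [← Finset.sum_mul, sum_traceChar_mul]
  split_ifs <;> simp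

open Classical in
/-- The size of a hyperplane section of a cone, in terms of a character sum. -/
theorem card_mul_card_hyperplane {D : Finset E} (hD : ∀ x ∈ D, ∀ c : F, c ≠ 0 → c • x ∈ D)
    (v : E) :
    (Fintype.card F : ℂ) * (D.filter fun x => Algebra.trace F E (v * x) = 0).card =
      D.card + (Fintype.card F - 1) * ∑ x ∈ D, traceChar p E (v * x) := by
  have h := card_mul_sum_hyperplane (p := p) (F := F) v D fun _ => 1
  simp only [Finset.sum_const, nsmul_eq_mul, mul_one] at h
  rw [h, ← Finset.add_sum_erase _ _ (Finset.mem_univ (0 : F))]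
  congr 1
  · simp
  · have : ∀ y ∈ Finset.univ.erase (0 : F), ∑ x ∈ D, traceChar p E (y • v * x) =
        ∑ x ∈ D, traceChar p E (v * x) := fun y hy => by
      have hy0 : y ≠ 0 := Finset.ne_of_mem_erase hy
      refine Finset.sum_nbij' (fun x => y • x) (fun x => y⁻¹ • x)
        (fun x hx => hD x hx y hy0) (fun x hx => hD x hx _ (inv_ne_zero hy0))
        (fun x _ => inv_smul_smul₀ hy0 x) (fun x _ => smul_inv_smul₀ hy0 x)
        (fun x _ => by rw [smul_mul_assoc, mul_smul_comm])
    rw [Finset.sum_eq_card_nsmul this, Finset.card_erase_of_mem (Finset.mem_univ _),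
      Finset.card_univ, nsmul_eq_mul, Nat.cast_sub Fintype.card_pos, Nat.cast_one]

open Classical in
theorem card_mul_sum_hyperplane_one_sub {v v' : E} (hv : v ≠ 0)
    (hne : ∀ y : F, y • v + v' ≠ 0) :
    Fintype.card F * ∑ x ∈ Finset.univ.filter (fun x => Algebra.trace F E (v * x) = 0),
      (1 - traceChar p E (v' * x)) = Fintype.card E := by
  rw [card_mul_sum_hyperplane (p := p)]
  have h : ∀ y : F, ∑ x : E, traceChar p E (y • v * x) * (1 - traceChar p E (v' * x)) =
      if y = 0 then (Fintype.card E : ℂ) else 0 := fun y => by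
    simp_rw [mul_sub, mul_one, ← AddChar.map_add_eq_mul, ← add_mul]
    rw [Finset.sum_sub_distrib, sum_traceChar_mul, sum_traceChar_mul, if_neg (hne y), sub_zero]
    simp [hv]
  simp_rw [h]
  simp

/-- If a set agrees with one trace hyperplane outside another, then two of its character values
are far apart. -/
theorem card_mul_sub_eq_of_symmDiff {D : Finset E} {v v' : E} (hv : v ≠ 0)
    (hne : ∀ y : F, y • v + v' ≠ 0)
    (h : ∀ x : E, x ≠ 0 → Algebra.trace F E (v' * x) ≠ 0 →
      (x ∈ D ↔ Algebra.trace F E (v * x) = 0)) :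
    (Fintype.card F : ℂ) *
      (∑ x ∈ D, traceChar p E (v * x) - ∑ x ∈ D, traceChar p E ((v + v') * x)) =
      Fintype.card E := by
  classical
  have hone : ∀ x, Algebra.trace F E (v' * x) = 0 → traceChar p E (v' * x) = 1 := fun x hx => by
    rw [traceChar_tower (F := F), hx, AddChar.map_zero_eq_one]
  rw [← card_mul_sum_hyperplane_one_sub (p := p) hv hne, ← Finset.sum_sub_distrib,
    ← Finset.sum_filter_of_ne (s := D) (p := fun x => Algebra.trace F E (v' * x) ≠ 0),
    ← Finset.sum_filter_of_ne (s := Finset.univ.filter fun x => Algebra.trace F E (v * x) = 0)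
      (p := fun x => Algebra.trace F E (v' * x) ≠ 0)]
  · congr 1
    refine Finset.sum_congr ?_ fun x hx => ?_
    · ext x
      simp only [Finset.mem_filter, Finset.mem_univ, true_and]
      refine and_congr_left fun hx => h x ?_ hx
      rintro rfl
      simp at hx
    · replace hx := (Finset.mem_filter.1 (Finset.mem_filter.1 hx).1).2
      rw [add_mul, AddChar.map_add_eq_mul, traceChar_tower (F := F) (v * x), hx,
        AddChar.map_zero_eq_one, one_mul]
  · exact fun x _ hx hx0 => hx (by rw [hone x hx0, sub_self])
  · exact fun x _ hx hx0 => hx (by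
      rw [add_mul, AddChar.map_add_eq_mul, hone x hx0, mul_one, sub_self])

/-- Over the field with two elements, if a set agrees on a hyperplane with the complement of
another hyperplane, then the sum of two of its character values is large. -/
theorem two_mul_add_eq_of_inter (hF : Fintype.card F = 2) {D : Finset E} (hD0 : (0 : E) ∉ D)
    {v v' : E} (hv : v ≠ 0) (hne : ∀ y : F, y • v + v' ≠ 0)
    (h : ∀ x : E, x ≠ 0 → Algebra.trace F E (v * x) = 0 →
      (x ∈ D ↔ Algebra.trace F E (v' * x) ≠ 0)) :
    2 * (∑ x ∈ D, traceChar p E (v' * x) + ∑ x ∈ D, traceChar p E ((v + v') * x)) =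
      -(Fintype.card E : ℂ) := by
  classical
  have huniv : (Finset.univ : Finset F) = {0, 1} := by
    symm
    refine Finset.eq_of_subset_of_card_le (Finset.subset_univ _) ?_
    rw [Finset.card_univ, hF, Finset.card_pair zero_ne_one]
  have hneg : ∀ x, Algebra.trace F E (v' * x) ≠ 0 → traceChar p E (v' * x) = -1 := fun x hx => by
    have h := sum_traceChar_mul (p := p) (Algebra.trace F E (v' * x))
    rw [if_neg hx, huniv, Finset.sum_pair zero_ne_one, mul_zero, mul_one,
      AddChar.map_zero_eq_one, ← traceChar_tower] at h
    exact (neg_eq_of_add_eq_zero_right h).symm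
  have hone : ∀ x, Algebra.trace F E (v' * x) = 0 → traceChar p E (v' * x) = 1 := fun x hx => by
    rw [traceChar_tower (F := F), hx, AddChar.map_zero_eq_one]
  have h1 := card_mul_sum_hyperplane (p := p) (F := F) v D fun x => traceChar p E (v' * x)
  have h2 := card_mul_sum_hyperplane_one_sub (p := p) hv hne
  have h3 : ∑ x ∈ Finset.univ.filter (fun x => Algebra.trace F E (v * x) = 0),
      (1 - traceChar p E (v' * x)) =
      -(2 * ∑ x ∈ D.filter (fun x => Algebra.trace F E (v * x) = 0), traceChar p E (v' * x)) := by
    rw [← Finset.sum_filter_of_ne (p := fun x => Algebra.trace F E (v' * x) ≠ 0)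
      fun x _ hx hx0 => hx (by rw [hone x hx0, sub_self]), Finset.mul_sum, ← Finset.sum_neg_distrib]
    refine Finset.sum_congr ?_ fun x hx => ?_
    · ext x
      simp only [Finset.mem_filter, Finset.mem_univ, true_and]
      by_cases hx : x = 0
      · simp [hx, hD0]
      · constructor
        · exact fun hh => ⟨(h x hx hh.1).2 hh.2, hh.1⟩
        · exact fun hh => ⟨hh.2, (h x hx hh.2).1 hh.1⟩
    · obtain ⟨hxD, hx⟩ := Finset.mem_filter.1 hx
      rw [hneg x ((h x (fun h0 => hD0 (h0 ▸ hxD)) hx).1 hxD)]; norm_num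
  rw [huniv, Finset.sum_pair zero_ne_one, hF] at h1
  simp only [zero_smul, one_smul, zero_mul, AddChar.map_zero_eq_one, one_mul,
    ← AddChar.map_add_eq_mul, ← add_mul] at h1
  rw [h3, hF] at h2
  push_cast at h1 h2
  rw [← h1]
  linear_combination -h2

end Hyperplanes

section Minimality

variable {F E : Type*} [Field F] [Field E] [Algebra F E]

open Classical in
theorem codewordMD_apply (D : Set E) (w : F × E) (x : {x : E // x ≠ 0}) :
    codewordMD F E D w x =
      w.1 * (if (x : E) ∈ D then 1 else 0) + Algebra.trace F E (w.2 * x) := by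
  rw [codewordMD, Set.indicator_apply]

variable [Fintype F] [Fintype E]

/-- A criterion for minimality of the code of a cone in terms of its hyperplane sections. -/
theorem codewordMD_minimal {D : Set E} (hD : ∀ x ∈ D, ∀ c : F, c ≠ 0 → c • x ∈ D)
    (hmeet : ∀ v : E, v ≠ 0 → ∃ x ≠ 0, x ∈ D ∧ Algebra.trace F E (v * x) = 0)
    (hcompl : ∀ v : E, v ≠ 0 → ∃ x ≠ 0, x ∉ D ∧ Algebra.trace F E (v * x) ≠ 0)
    (hdiff : ∀ v v' : E, v ≠ 0 → v' ≠ 0 → ∃ x ≠ 0, Algebra.trace F E (v' * x) ≠ 0 ∧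
      ¬(x ∈ D ↔ Algebra.trace F E (v * x) = 0))
    (htwo : Fintype.card F = 2 → ∀ v v' : E, v ≠ 0 → v' ≠ 0 → ∃ x ≠ 0,
      Algebra.trace F E (v * x) = 0 ∧ (x ∈ D ↔ Algebra.trace F E (v' * x) = 0))
    (w : F × E) (hw : codewordMD F E D w ≠ 0) (w' : F × E)
    (hsupp : Function.support (codewordMD F E D w') ⊆ Function.support (codewordMD F E D w)) :
    ∃ a : F, codewordMD F E D w' = a • codewordMD F E D w := by
  classical
  obtain ⟨u, v⟩ := w
  obtain ⟨u', v'⟩ := w'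
  have hz : ∀ x : E, x ≠ 0 → u * (if x ∈ D then 1 else 0) + Algebra.trace F E (v * x) = 0 →
      u' * (if x ∈ D then 1 else 0) + Algebra.trace F E (v' * x) = 0 := by
    intro x hx h
    by_contra h'
    refine hsupp (a := ⟨x, hx⟩) ?_ ?_
    · rwa [Function.mem_support, codewordMD_apply]
    · rwa [codewordMD_apply]
  by_cases hu : u = 0
  · subst hu
    simp only [zero_mul, zero_add] at hz
    have hv : v ≠ 0 := by
      rintro rfl
      refine hw (funext fun x => ?_)
      rw [codewordMD_apply]
      simp
    have hu' : u' = 0 := by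
      by_contra hu'
      by_cases hF : Fintype.card F = 2 ∧ v' ≠ 0
      · obtain ⟨x, hx, hvx, hiff⟩ := htwo hF.1 v v' hv hF.2
        have h := hz x hx hvx
        by_cases hxD : x ∈ D
        · rw [if_pos hxD, hiff.1 hxD, mul_one, add_zero] at h
          exact hu' h
        · rw [if_neg hxD, mul_zero, zero_add] at h
          exact hxD (hiff.2 h)
      · obtain ⟨x, hx, hxD, hvx⟩ := hmeet v hv
        have h := hz x hx hvx
        rw [if_pos hxD, mul_one] at h
        have hT : Algebra.trace F E (v' * x) = 0 := by
          by_cases hv' : v' = 0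
          · simp [hv']
          have hF2 : Fintype.card F ≠ 2 := fun hF2 => hF ⟨hF2, hv'⟩
          have hF1 := Fintype.one_lt_card (α := F)
          obtain ⟨c, -, hc⟩ := Finset.exists_mem_notMem_of_card_lt_card
            (s := ({0, 1} : Finset F)) (t := Finset.univ)
            (by rw [Finset.card_pair zero_ne_one, Finset.card_univ]; omega)
          simp only [Finset.mem_insert, Finset.mem_singleton, not_or] at hc
          have h2 := hz (c • x) (smul_ne_zero hc.1 hx) (by simp [hvx])
          rw [if_pos (hD x hxD c hc.1), mul_one, mul_smul_comm, map_smul, smul_eq_mul] at h2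
          refine (mul_eq_zero.1 (?_ : (c - 1) * _ = 0)).resolve_left (sub_ne_zero.2 hc.2)
          linear_combination h2 - h
        rw [hT, add_zero] at h
        exact hu' h
    subst hu'
    simp only [zero_mul, zero_add] at hz
    obtain ⟨x₀, hx₀⟩ := Algebra.trace_surjective F E 1
    refine ⟨Algebra.trace F E (v' * (v⁻¹ * x₀)), funext fun x => ?_⟩
    rw [Pi.smul_apply, codewordMD_apply, codewordMD_apply]
    simp only [zero_mul, zero_add, smul_eq_mul]
    have hk : Algebra.trace F E (v * (x - Algebra.trace F E (v * x) • (v⁻¹ * x₀))) = 0 := by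
      rw [mul_sub, mul_smul_comm, mul_inv_cancel_left₀ hv, map_sub, map_smul, hx₀, smul_eq_mul,
        mul_one, sub_self]
    have hk' : Algebra.trace F E (v' * (x - Algebra.trace F E (v * x) • (v⁻¹ * x₀))) = 0 := by
      by_cases h0 : (x - Algebra.trace F E (v * x) • (v⁻¹ * x₀) : E) = 0
      · simp [h0]
      · exact hz _ h0 hk
    rw [mul_sub, mul_smul_comm, map_sub, map_smul, smul_eq_mul] at hk'
    linear_combination hk'
  · have hz' : ∀ x : E, x ≠ 0 → u * (if x ∈ D then 1 else 0) + Algebra.trace F E (v * x) = 0 →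
        Algebra.trace F E ((v' - (u' / u) • v) * x) = 0 := by
      intro x hx h
      rw [sub_mul, smul_mul_assoc, map_sub, map_smul, smul_eq_mul]
      have h' := hz x hx h
      have hdiv : u' / u * u = u' := div_mul_cancel₀ _ hu
      linear_combination h' - u' / u * h + hdiv * (if x ∈ D then 1 else 0)
    have hv0 : v' - (u' / u) • v = 0 := by
      by_contra hne
      by_cases hv : v = 0
      · subst hv
        obtain ⟨x, hx, hxD, hT⟩ := hcompl _ hne
        exact hT (hz' x hx (by simp [hxD]))
      · obtain ⟨x, hx, hT, hiff⟩ := hdiff v _ hv hne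
        by_cases hxD : x ∈ D
        · have hvx : Algebra.trace F E (v * x) ≠ 0 := fun h => hiff (iff_of_true hxD h)
          have hc : -u / Algebra.trace F E (v * x) ≠ 0 := div_ne_zero (neg_ne_zero.2 hu) hvx
          have h := hz' ((-u / Algebra.trace F E (v * x)) • x) (smul_ne_zero hc hx) (by
            rw [if_pos (hD x hxD _ hc), mul_smul_comm, map_smul, smul_eq_mul,
              div_mul_cancel₀ _ hvx]
            ring)
          rw [mul_smul_comm, map_smul, smul_eq_mul] at h
          exact (mul_ne_zero hc hT) h
        · have hvx : Algebra.trace F E (v * x) = 0 := by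
            by_contra h
            exact hiff (iff_of_false hxD h)
          exact hT (hz' x hx (by rw [if_neg hxD, hvx]; ring))
    refine ⟨u' / u, funext fun x => ?_⟩
    rw [Pi.smul_apply, codewordMD_apply, codewordMD_apply]
    simp only [smul_eq_mul]
    rw [sub_eq_zero.1 hv0, smul_mul_assoc, map_smul, smul_eq_mul]
    field_simp

end Minimality

section TwoCharacterValues

variable {p : ℕ} [Fact p.Prime] {F E : Type*} [Field F] [Field E] [Fintype F] [Fintype E]
  [Algebra F E] [Algebra (ZMod p) F] [Algebra (ZMod p) E] {D : Finset E} {N u : ℕ} {σ : ℤ}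

theorem exists_mem_trace_eq_zero (hDN : (D.card : ℤ) * N = u * (σ ^ 2 - 1))
    (hD : ∀ x ∈ D, ∀ c : F, c ≠ 0 → c • x ∈ D)
    (hval : ∀ v : E, v ≠ 0 → ∃ δ : ℕ, δ ≤ 1 ∧
      (N : ℂ) * ∑ x ∈ D, traceChar p E (v * x) = u * (σ - 1) - σ * N * δ)
    (h0 : (u : ℤ) * (σ - 1) * (σ + Fintype.card F) ≠ 0)
    (h1 : (u : ℤ) * (σ - 1) * (σ + Fintype.card F) ≠ (Fintype.card F - 1) * σ * N)
    {v : E} (hv : v ≠ 0) : ∃ x ∈ D, Algebra.trace F E (v * x) = 0 := by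
  classical
  by_contra! hne
  obtain ⟨δ, hδ, hχ⟩ := hval v hv
  have h := card_mul_card_hyperplane (p := p) hD v
  rw [Finset.filter_eq_empty_iff.2 (fun x hx => hne x hx), Finset.card_empty] at h
  have hDN' : (D.card : ℂ) * N = u * (σ ^ 2 - 1) := by exact_mod_cast hDN
  have key : (u : ℂ) * (σ - 1) * (σ + Fintype.card F) = (Fintype.card F - 1) * σ * N * δ := by
    push_cast at h
    linear_combination -hDN' - (Fintype.card F - 1 : ℂ) * hχ - (N : ℂ) * h
  have key' : (u : ℤ) * (σ - 1) * (σ + Fintype.card F) = (Fintype.card F - 1) * σ * N * δ := by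
    exact_mod_cast key
  interval_cases δ
  · exact h0 (by simpa using key')
  · exact h1 (by simpa using key')

theorem sum_traceChar_of_trace_eq_zero {A : Finset E} {v : E}
    (h : ∀ x ∈ A, Algebra.trace F E (v * x) = 0) : ∑ x ∈ A, traceChar p E (v * x) = A.card := by
  rw [Finset.sum_congr rfl fun x hx => by
    rw [traceChar_tower (F := F), h x hx, AddChar.map_zero_eq_one]]
  simp

theorem exists_notMem_trace_ne_zero (hE : (Fintype.card E : ℤ) = σ ^ 2) (hσ : σ ≠ 0)
    (hDN : (D.card : ℤ) * N = u * (σ ^ 2 - 1))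
    (hval : ∀ v : E, v ≠ 0 → ∃ δ : ℕ, δ ≤ 1 ∧
      (N : ℂ) * ∑ x ∈ D, traceChar p E (v * x) = u * (σ - 1) - σ * N * δ)
    (h0 : (u : ℤ) * (σ - 1) ≠ N * σ) (h1 : (u : ℤ) * (σ - 1) ≠ N * (σ - 1))
    {v : E} (hv : v ≠ 0) : ∃ x ∉ D, Algebra.trace F E (v * x) ≠ 0 := by
  classical
  by_contra! hne
  obtain ⟨δ, hδ, hχ⟩ := hval v hv
  have h := sum_traceChar_of_trace_eq_zero (p := p) (F := F) (A := Dᶜ)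
    fun x hx => hne x (Finset.mem_compl.1 hx)
  have hsum := Finset.sum_add_sum_compl D fun x => traceChar p E (v * x)
  rw [sum_traceChar_mul, if_neg hv, h] at hsum
  have hcard : (D.card : ℂ) + Dᶜ.card = σ ^ 2 := by
    have := Finset.card_add_card_compl D
    rw [← Int.cast_pow, ← hE]
    exact_mod_cast this
  have hDN' : (D.card : ℂ) * N = u * (σ ^ 2 - 1) := by exact_mod_cast hDN
  have key : (σ : ℂ) * (u * (σ - 1)) = σ * (N * (σ - δ)) := by
    linear_combination (-N : ℂ) * hsum + hχ + N * hcard - hDN'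
  have key' : σ * ((u : ℤ) * (σ - 1)) = σ * (N * (σ - δ)) := by exact_mod_cast key
  have key'' := mul_left_cancel₀ hσ key'
  interval_cases δ
  · exact h0 (by simpa using key'')
  · exact h1 (by simpa using key'')

theorem exists_mem_trace_ne_zero (hσ : σ ≠ 0)
    (hDN : (D.card : ℤ) * N = u * (σ ^ 2 - 1))
    (hval : ∀ v : E, v ≠ 0 → ∃ δ : ℕ, δ ≤ 1 ∧
      (N : ℂ) * ∑ x ∈ D, traceChar p E (v * x) = u * (σ - 1) - σ * N * δ)
    (h0 : (u : ℤ) * (σ - 1) ≠ 0) (h1 : (u : ℤ) * (σ - 1) ≠ -N)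
    {v : E} (hv : v ≠ 0) : ∃ x ∈ D, Algebra.trace F E (v * x) ≠ 0 := by
  by_contra! hne
  obtain ⟨δ, hδ, hχ⟩ := hval v hv
  have h := sum_traceChar_of_trace_eq_zero (p := p) (F := F) hne
  have hDN' : (D.card : ℂ) * N = u * (σ ^ 2 - 1) := by exact_mod_cast hDN
  have key : (σ : ℂ) * (u * (σ - 1)) = σ * (-N * δ) := by
    linear_combination hχ - N * h - hDN'
  have key' : σ * ((u : ℤ) * (σ - 1)) = σ * (-N * δ) := by exact_mod_cast key
  have key'' := mul_left_cancel₀ hσ key'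
  interval_cases δ
  · exact h0 (by simpa using key'')
  · exact h1 (by simpa using key'')

theorem exists_not_iff_trace_eq_zero (hE : (Fintype.card E : ℤ) = σ ^ 2) (hN : 0 < N)
    (hσ : (Fintype.card F : ℤ) < |σ|)
    (hval : ∀ v : E, v ≠ 0 → ∃ δ : ℕ, δ ≤ 1 ∧
      (N : ℂ) * ∑ x ∈ D, traceChar p E (v * x) = u * (σ - 1) - σ * N * δ)
    {v v' : E} (hv : v ≠ 0) (hne : ∀ y : F, y • v + v' ≠ 0) :
    ∃ x ≠ 0, Algebra.trace F E (v' * x) ≠ 0 ∧ ¬(x ∈ D ↔ Algebra.trace F E (v * x) = 0) := by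
  by_contra! h
  have heq := card_mul_sub_eq_of_symmDiff (p := p) hv hne h
  obtain ⟨δ₁, hδ₁, h₁⟩ := hval v hv
  obtain ⟨δ₂, hδ₂, h₂⟩ := hval (v + v') (by simpa using hne 1)
  have hE' : (Fintype.card E : ℂ) = σ ^ 2 := by exact_mod_cast hE
  have key : (N : ℂ) * σ * σ = N * σ * (Fintype.card F * (δ₂ - δ₁)) := by
    linear_combination (-N : ℂ) * heq + Fintype.card F * h₁ - Fintype.card F * h₂ - N * hE'
  have key' : (N : ℤ) * σ * σ = N * σ * (Fintype.card F * (δ₂ - δ₁)) := by exact_mod_cast key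
  have hσ0 : σ ≠ 0 := by
    rintro rfl
    rw [abs_zero] at hσ
    omega
  have key'' := mul_left_cancel₀ (mul_ne_zero (by exact_mod_cast hN.ne') hσ0) key'
  rw [key'', abs_mul, Nat.abs_cast] at hσ
  have hle : |(δ₂ - δ₁ : ℤ)| ≤ 1 := abs_le.2 ⟨by omega, by omega⟩
  nlinarith

theorem exists_iff_trace_eq_zero (hF : Fintype.card F = 2) (hE : (Fintype.card E : ℤ) = σ ^ 2)
    (hD0 : (0 : E) ∉ D) (hN : 0 < N) (huN : u ≤ N) (hσ : 5 ≤ |σ|)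
    (hval : ∀ v : E, v ≠ 0 → ∃ δ : ℕ, δ ≤ 1 ∧
      (N : ℂ) * ∑ x ∈ D, traceChar p E (v * x) = u * (σ - 1) - σ * N * δ)
    {v v' : E} (hv : v ≠ 0) (hne : ∀ y : F, y • v + v' ≠ 0) :
    ∃ x ≠ 0, Algebra.trace F E (v * x) = 0 ∧ (x ∈ D ↔ Algebra.trace F E (v' * x) = 0) := by
  by_contra! h
  have heq := two_mul_add_eq_of_inter (p := p) hF hD0 hv hne fun x hx hvx => by
    have := h x hx hvx
    tauto
  obtain ⟨δ₁, hδ₁, h₁⟩ := hval v' (by simpa using hne 0)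
  obtain ⟨δ₂, hδ₂, h₂⟩ := hval (v + v') (by simpa using hne 1)
  have hE' : (Fintype.card E : ℂ) = σ ^ 2 := by exact_mod_cast hE
  have key : 4 * (u : ℂ) * (σ - 1) - 2 * σ * N * (δ₁ + δ₂) = -(N * σ ^ 2) := by
    linear_combination N * heq - 2 * h₁ - 2 * h₂ - N * hE'
  have key' : 4 * (u : ℤ) * (σ - 1) - 2 * σ * N * (δ₁ + δ₂) = -(N * σ ^ 2) := by
    exact_mod_cast key
  have hN' : (0 : ℤ) < N := by exact_mod_cast hN
  have huN' : (u : ℤ) ≤ N := by exact_mod_cast huN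
  have hu' : (0 : ℤ) ≤ u := by positivity
  have hδ : (δ₁ + δ₂ : ℤ) ≤ 2 := by omega
  have hδ0 : (0 : ℤ) ≤ δ₁ + δ₂ := by positivity
  rcases le_abs.1 hσ with hσ | hσ
  · have e1 : (0 : ℤ) ≤ u * (σ - 1) := mul_nonneg hu' (by linarith)
    have e2 : σ * N * (δ₁ + δ₂ : ℤ) ≤ σ * N * 2 :=
      mul_le_mul_of_nonneg_left hδ (mul_nonneg (by linarith) hN'.le)
    have e3 : 0 < N * σ * (σ - 4) := mul_pos (mul_pos hN' (by linarith)) (by linarith)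
    nlinarith
  · have e1 : u * (1 - σ) ≤ N * (1 - σ) := mul_le_mul_of_nonneg_right huN' (by linarith)
    have e2 : 0 ≤ -σ * N * (δ₁ + δ₂ : ℤ) := mul_nonneg (mul_nonneg (by linarith) hN'.le) hδ0
    have e3 : 0 < N * (σ ^ 2 + 4 * σ - 4) := mul_pos hN' (by nlinarith)
    nlinarith

end TwoCharacterValues

section TwoValueMinimality

variable {p : ℕ} [Fact p.Prime] {F E : Type*} [Field F] [Field E] [Fintype F] [Fintype E]
  [Algebra F E] [Algebra (ZMod p) F] [Algebra (ZMod p) E] {D : Finset E} {N u : ℕ} {σ : ℤ}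

theorem codewordMD_minimal_of_two_values (hE : (Fintype.card E : ℤ) = σ ^ 2)
    (hσ : (Fintype.card F : ℤ) < |σ|) (hσ' : Fintype.card F = 2 → 5 ≤ |σ|)
    (hD0 : (0 : E) ∉ D) (hD : ∀ x ∈ D, ∀ c : F, c ≠ 0 → c • x ∈ D) (huN : u < N)
    (hDN : (D.card : ℤ) * N = u * (σ ^ 2 - 1))
    (hval : ∀ v : E, v ≠ 0 → ∃ δ : ℕ, δ ≤ 1 ∧
      (N : ℂ) * ∑ x ∈ D, traceChar p E (v * x) = u * (σ - 1) - σ * N * δ)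
    (hu : (u : ℤ) * (σ - 1) ≠ 0) (hu₁ : (u : ℤ) * (σ - 1) ≠ -N)
    (hu₂ : (u : ℤ) * (σ - 1) ≠ N * σ)
    (hu₃ : (u : ℤ) * (σ - 1) * (σ + Fintype.card F) ≠ (Fintype.card F - 1) * σ * N)
    (w : F × E) (hw : codewordMD F E (D : Set E) w ≠ 0) (w' : F × E)
    (hsupp : Function.support (codewordMD F E (D : Set E) w') ⊆
      Function.support (codewordMD F E (D : Set E) w)) :
    ∃ a : F, codewordMD F E (D : Set E) w' = a • codewordMD F E (D : Set E) w := by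
  have hN : 0 < N := by omega
  have hσ0 : σ ≠ 0 := by
    rintro rfl
    rw [abs_zero] at hσ
    omega
  have hσF : σ + Fintype.card F ≠ 0 := by
    intro h
    rw [eq_neg_of_add_eq_zero_left h, abs_neg, Nat.abs_cast] at hσ
    exact lt_irrefl _ hσ
  have hσ1 : σ - 1 ≠ 0 := right_ne_zero_of_mul hu
  have hmeet : ∀ v : E, v ≠ 0 → ∃ x ≠ 0, x ∈ D ∧ Algebra.trace F E (v * x) = 0 := by
    intro v hv
    obtain ⟨x, hx, h⟩ := exists_mem_trace_eq_zero hDN hD hval (mul_ne_zero hu hσF) hu₃ hv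
    exact ⟨x, ne_of_mem_of_not_mem hx hD0, hx, h⟩
  have htrace : ∀ {y : F} {v v' : E}, y • v + v' = 0 → ∀ x : E,
      Algebra.trace F E (v' * x) = -y * Algebra.trace F E (v * x) := by
    intro y v v' h x
    rw [eq_neg_of_add_eq_zero_right h, neg_mul, map_neg, smul_mul_assoc, map_smul, smul_eq_mul,
      neg_mul]
  have hscalar : ∀ {y : F} {v v' : E}, v' ≠ 0 → y • v + v' = 0 → y ≠ 0 := by
    rintro y v v' hv' h rfl
    rw [zero_smul, zero_add] at h
    exact hv' h
  refine codewordMD_minimal (fun x hx c hc => hD x hx c hc) hmeet ?_ ?_ ?_ w hw w' hsupp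
  · intro v hv
    obtain ⟨x, hx, h⟩ := exists_notMem_trace_ne_zero (F := F) hE hσ0 hDN hval hu₂
      (fun h => huN.ne (by exact_mod_cast mul_right_cancel₀ hσ1 h)) hv
    exact ⟨x, by rintro rfl; simp at h, hx, h⟩
  · intro v v' hv hv'
    by_cases hvv : ∃ y : F, y • v + v' = 0
    · obtain ⟨y, hy⟩ := hvv
      obtain ⟨x, hx, h⟩ := exists_mem_trace_ne_zero (F := F) hσ0 hDN hval hu hu₁ hv
      refine ⟨x, ne_of_mem_of_not_mem hx hD0, ?_, fun hiff => h (hiff.1 hx)⟩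
      rw [htrace hy]
      exact mul_ne_zero (neg_ne_zero.2 (hscalar hv' hy)) h
    · push Not at hvv
      exact exists_not_iff_trace_eq_zero hE hN hσ hval hv hvv
  · intro hF v v' hv hv'
    by_cases hvv : ∃ y : F, y • v + v' = 0
    · obtain ⟨y, hy⟩ := hvv
      obtain ⟨x, hx0, hx, h⟩ := hmeet v hv
      exact ⟨x, hx0, h, iff_of_true hx (by rw [htrace hy, h, mul_zero])⟩
    · push Not at hvv
      exact exists_iff_trace_eq_zero hF hE hD0 hN huN.le (hσ' hF) hval hv hvv

end TwoValueMinimality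

section Cyclotomy

variable {E : Type*} [Field E] {γ : E} {n N : ℕ} {J : Finset (ZMod N)}

/-- The union of the cyclotomic classes of order `N` with index in `J`, where `γ` is a primitive
`n`-th root of unity. -/
def cyclotomicUnion (γ : E) (n : ℕ) (J : Finset (ZMod N)) : Set E :=
  {x : E | ∃ j ∈ J, ∃ k < n / N, x = γ ^ (k * N + ZMod.val j)}

theorem zero_notMem_cyclotomicUnion (hγ : γ ≠ 0) : (0 : E) ∉ cyclotomicUnion γ n J := by
  rintro ⟨j, -, k, -, h⟩
  exact pow_ne_zero _ hγ h.symm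

variable [NeZero N]

theorem mul_add_val_lt (hN : N ∣ n) {k : ℕ} (hk : k < n / N) (j : ZMod N) :
    k * N + ZMod.val j < n := by
  obtain ⟨l, rfl⟩ := hN
  rw [Nat.mul_div_cancel_left _ (NeZero.pos N)] at hk
  have := ZMod.val_lt j
  nlinarith

theorem pow_mem_cyclotomicUnion (hγ : IsPrimitiveRoot γ n) (hn : 0 < n) (hN : N ∣ n) (i : ℕ) :
    γ ^ i ∈ cyclotomicUnion γ n J ↔ (i : ZMod N) ∈ J := by
  constructor
  · rintro ⟨j, hj, k, -, h⟩
    have hmod : i ≡ k * N + ZMod.val j [MOD N] := by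
      refine Nat.ModEq.of_dvd hN ?_
      rw [hγ.eq_orderOf]
      exact (hγ.isOfFinOrder hn.ne').pow_eq_pow_iff_modEq.1 h
    rw [(ZMod.natCast_eq_natCast_iff _ _ _).2 hmod]
    simpa using hj
  · intro h
    have hlt := Nat.mod_lt i hn
    refine ⟨_, h, (i % n) / N, Nat.div_lt_div_of_lt_of_dvd hN hlt, ?_⟩
    rw [ZMod.val_natCast, ← Nat.mod_mod_of_dvd i hN, Nat.div_add_mod', hγ.eq_orderOf,
      pow_mod_orderOf]

theorem card_cyclotomicUnion (hγ : IsPrimitiveRoot γ n) (hN : N ∣ n) {D : Finset E}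
    (hD : (D : Set E) = cyclotomicUnion γ n J) : D.card * N = J.card * n := by
  classical
  have himage : D = (J ×ˢ Finset.range (n / N)).image fun a => γ ^ (a.2 * N + ZMod.val a.1) := by
    ext x
    rw [← Finset.mem_coe, hD]
    simp only [cyclotomicUnion, Set.mem_ofPred_eq, Finset.mem_image, Finset.mem_product,
      Finset.mem_range, Prod.exists]
    constructor
    · rintro ⟨j, hj, k, hk, rfl⟩
      exact ⟨j, k, ⟨hj, hk⟩, rfl⟩
    · rintro ⟨j, k, ⟨hj, hk⟩, rfl⟩
      exact ⟨j, hj, k, hk, rfl⟩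
  rw [himage, Finset.card_image_of_injOn, Finset.card_product, Finset.card_range, mul_assoc,
    Nat.div_mul_cancel hN]
  rintro ⟨j, k⟩ ha ⟨j', k'⟩ hb h
  simp only [Finset.coe_product, Finset.coe_range, Set.mem_prod, Set.mem_Iio] at ha hb
  have heq : k * N + ZMod.val j = k' * N + ZMod.val j' :=
    hγ.pow_inj (mul_add_val_lt hN ha.2 j) (mul_add_val_lt hN hb.2 j') h
  have hj : j = j' := by
    have := congrArg (Nat.cast : ℕ → ZMod N) heq
    simpa using this
  subst hj
  have hk : k = k' := Nat.eq_of_mul_eq_mul_right (NeZero.pos N) (Nat.add_right_cancel heq)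
  rw [hk]

variable [Fintype E]

theorem mul_pow_mem_cyclotomicUnion (hγ : IsPrimitiveRoot γ (Fintype.card E - 1))
    (hN : N ∣ Fintype.card E - 1) {a : ℕ} (ha : N ∣ a) {x y : E}
    (hx : x ∈ cyclotomicUnion γ (Fintype.card E - 1) J) (hy : y ≠ 0) :
    x * y ^ a ∈ cyclotomicUnion γ (Fintype.card E - 1) J := by
  have hn : 0 < Fintype.card E - 1 := Nat.sub_pos_of_lt Fintype.one_lt_card
  obtain ⟨i, -, rfl⟩ := exists_nat_pow_eq hγ hy
  have hx0 : x ≠ 0 := by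
    rintro rfl
    exact zero_notMem_cyclotomicUnion (hγ.ne_zero hn.ne') hx
  obtain ⟨k, -, rfl⟩ := exists_nat_pow_eq hγ hx0
  rw [pow_mem_cyclotomicUnion hγ hn hN] at hx
  rw [← pow_mul, ← pow_add, pow_mem_cyclotomicUnion hγ hn hN, Nat.cast_add, Nat.cast_mul,
    (ZMod.natCast_eq_zero_iff _ _).2 ha, mul_zero, add_zero]
  exact hx

theorem smul_mem_cyclotomicUnion {F : Type*} [Field F] [Fintype F] [Algebra F E]
    (hγ : IsPrimitiveRoot γ (Fintype.card E - 1))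
    (hN : N ∣ Fintype.card E - 1)
    (hJ : ∀ j ∈ J, j + (((Fintype.card E - 1) / (Fintype.card F - 1) : ℕ) : ZMod N) ∈ J)
    {x : E} (hx : x ∈ cyclotomicUnion γ (Fintype.card E - 1) J) {c : F} (hc : c ≠ 0) :
    c • x ∈ cyclotomicUnion γ (Fintype.card E - 1) J := by
  have hn : 0 < Fintype.card E - 1 := Nat.sub_pos_of_lt Fintype.one_lt_card
  have hq : 0 < Fintype.card F - 1 := Nat.sub_pos_of_lt Fintype.one_lt_card
  have hc' : algebraMap F E c ≠ 0 := by simpa using hc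
  obtain ⟨i, -, hi⟩ := exists_nat_pow_eq hγ hc'
  have hx0 : x ≠ 0 := by
    rintro rfl
    exact zero_notMem_cyclotomicUnion (hγ.ne_zero hn.ne') hx
  obtain ⟨k, -, rfl⟩ := exists_nat_pow_eq hγ hx0
  have hdvd : (Fintype.card E - 1) / (Fintype.card F - 1) ∣ i := by
    have h1 : γ ^ (i * (Fintype.card F - 1)) = 1 := by
      rw [pow_mul, hi, ← map_pow, FiniteField.pow_card_sub_one_eq_one c hc, map_one]
    have h2 : Fintype.card F - 1 ∣ Fintype.card E - 1 := by
      rw [Module.card_eq_pow_finrank (K := F) (V := E)]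
      exact Nat.sub_one_dvd_pow_sub_one _ _
    rw [Nat.div_dvd_iff_dvd_mul h2 hq, mul_comm]
    exact hγ.dvd_of_pow_eq_one _ h1
  obtain ⟨b, rfl⟩ := hdvd
  rw [pow_mem_cyclotomicUnion hγ hn hN] at hx
  rw [Algebra.smul_def, ← hi, ← pow_add, pow_mem_cyclotomicUnion hγ hn hN]
  clear hi
  induction b with
  | zero => simpa using hx
  | succ b ih =>
    convert hJ _ ih using 1
    push_cast
    ring

end Cyclotomy

/-- Minimal linear codes from cyclotomy (Theorem 3.13 of the paper).  Let
`q = p^e`, `m ≥ 4`, `(m,q) ≠ (4,2)`, `2 ∣ em`, `s = p^{em/2}`, `N ∣ q^m − 1`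
with `1 < N < q^m − 1` and `p^{ℓ1} ≡ −1 (mod N)` with `ℓ1` minimal,
`em = 2ℓ1·t`.  Let `J ⊊ Z_N`, `u = |J|`, with the extra conditions
`N ∣ (q^m−1)/2` and `J + (q^m−1)/2 ≡ J (mod N)` when `q` is odd, and let
`D = D_J = ∪_{j∈J} C_j`.  If `J` is `ρ`-invariant and either (1) `t` is odd,
`u ≠ sN/(s+1)`, `u > N/(s+1)`, or (2) `t` is even and
`u > (q−1)sN/((s+q)(s−1))`, then `C(M_D)` is a minimal linear code. -/
theorem minimal_of_cyclotomy {p e m q N ℓ1 t : ℕ} [Fact p.Prime] (he : 0 < e)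
    (hm : 4 ≤ m) (hmq : ¬(m = 4 ∧ q = 2)) (hq : q = p ^ e) (hem : 2 ∣ e * m)
    {F E : Type*} [Field F] [Field E] [Fintype F] [Fintype E] [Algebra F E]
    (hF : Fintype.card F = q) (hE : Fintype.card E = q ^ m)
    (hN : N ∣ q ^ m - 1) (hN1 : 1 < N) (hN2 : N < q ^ m - 1)
    (hl1 : 0 < ℓ1) (hl1neg : ((p : ZMod N)) ^ ℓ1 = -1)
    (hl1min : ∀ l : ℕ, 0 < l → ((p : ZMod N)) ^ l = -1 → ℓ1 ≤ l)
    (ht : e * m = 2 * ℓ1 * t)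
    (γ : E) (hγ : orderOf γ = q ^ m - 1)
    (J : Finset (ZMod N)) (hJproper : (J : Set (ZMod N)) ≠ Set.univ)
    (hodd : Odd q → (N ∣ (q ^ m - 1) / 2 ∧
      Finset.image (fun j : ZMod N => j + (((q ^ m - 1) / 2 : ℕ) : ZMod N)) J = J))
    (hrho : Finset.image
      (fun j : ZMod N => j + (((q ^ m - 1) / (q - 1) : ℕ) : ZMod N)) J = J)
    (hcond :
      (Odd t ∧
        (J.card : ℚ) ≠ ((p ^ (e * m / 2) : ℕ) : ℚ) * N / (((p ^ (e * m / 2) : ℕ) : ℚ) + 1) ∧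
        (J.card : ℚ) > (N : ℚ) / (((p ^ (e * m / 2) : ℕ) : ℚ) + 1)) ∨
      (Even t ∧
        (J.card : ℚ) > (((q : ℚ) - 1) * ((p ^ (e * m / 2) : ℕ) : ℚ) * N) /
          ((((p ^ (e * m / 2) : ℕ) : ℚ) + q) * (((p ^ (e * m / 2) : ℕ) : ℚ) - 1)))) :
    ∀ w : F × E,
      codewordMD F E {x : E | ∃ j ∈ J, ∃ k < (q ^ m - 1) / N, x = γ ^ (k * N + ZMod.val j)} w ≠ 0 →
      ∀ w' : F × E,
        Function.support
            (codewordMD F E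
              {x : E | ∃ j ∈ J, ∃ k < (q ^ m - 1) / N, x = γ ^ (k * N + ZMod.val j)} w') ⊆
          Function.support
            (codewordMD F E
              {x : E | ∃ j ∈ J, ∃ k < (q ^ m - 1) / N, x = γ ^ (k * N + ZMod.val j)} w) →
        ∃ a : F,
          codewordMD F E {x : E | ∃ j ∈ J, ∃ k < (q ^ m - 1) / N, x = γ ^ (k * N + ZMod.val j)} w' =
            a • codewordMD F E
              {x : E | ∃ j ∈ J, ∃ k < (q ^ m - 1) / N, x = γ ^ (k * N + ZMod.val j)} w := by
  classical
  subst hF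
  rw [← hE] at hN hγ hrho ⊢
  change ∀ w : F × E, codewordMD F E (cyclotomicUnion γ (Fintype.card E - 1) J) w ≠ 0 →
    ∀ w' : F × E, Function.support (codewordMD F E (cyclotomicUnion γ (Fintype.card E - 1) J) w') ⊆
      Function.support (codewordMD F E (cyclotomicUnion γ (Fintype.card E - 1) J) w) →
    ∃ a : F, codewordMD F E (cyclotomicUnion γ (Fintype.card E - 1) J) w' =
      a • codewordMD F E (cyclotomicUnion γ (Fintype.card E - 1) J) w
  have : NeZero N := ⟨by omega⟩
  have : CharP F p := charP_of_card_eq_prime_pow hq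
  have : CharP E p := charP_of_injective_algebraMap (algebraMap F E).injective p
  let _ := ZMod.algebra F p
  let _ := ZMod.algebra E p
  have hp : p.Prime := Fact.out
  have hγ' : IsPrimitiveRoot γ (Fintype.card E - 1) := hγ ▸ IsPrimitiveRoot.orderOf γ
  have hn : 0 < Fintype.card E - 1 := Nat.sub_pos_of_lt Fintype.one_lt_card
  have hF1 : 1 < Fintype.card F := Fintype.one_lt_card
  obtain ⟨D, hD⟩ : ∃ D : Finset E, (D : Set E) = cyclotomicUnion γ (Fintype.card E - 1) J :=
    ⟨_, Set.coe_toFinset _⟩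
  have hmem : ∀ x, x ∈ D ↔ x ∈ cyclotomicUnion γ (Fintype.card E - 1) J := fun x => by
    rw [← hD, Finset.mem_coe]
  have hD0 : (0 : E) ∉ D := by
    rw [hmem]
    exact zero_notMem_cyclotomicUnion (hγ'.ne_zero hn.ne')
  have hcard := card_cyclotomicUnion hγ' hN hD
  have hsmul : ∀ x ∈ D, ∀ c : F, c ≠ 0 → c • x ∈ D := by
    intro x hx c hc
    rw [hmem] at hx ⊢
    refine smul_mem_cyclotomicUnion hγ' hN (fun j hj => ?_) hx hc
    have := Finset.mem_image_of_mem
      (fun j : ZMod N => j + (((Fintype.card E - 1) / (Fintype.card F - 1) : ℕ) : ZMod N)) hj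
    rwa [hrho] at this
  have hpow : ∀ x ∈ D, ∀ y, y ≠ 0 → x * y ^ (p ^ ℓ1 + 1) ∈ D := by
    intro x hx y hy
    rw [hmem] at hx ⊢
    refine mul_pow_mem_cyclotomicUnion hγ' hN ?_ hx hy
    rw [← ZMod.natCast_eq_zero_iff]
    push_cast
    rw [hl1neg, neg_add_cancel]
  have huN : J.card < N := by
    have h := Finset.card_lt_univ_of_notMem
      (Set.ne_univ_iff_exists_notMem (J : Set (ZMod N)) |>.1 hJproper).choose_spec
    rwa [ZMod.card] at h
  obtain ⟨s, hs⟩ : ∃ s, s = p ^ (e * m / 2) := ⟨_, rfl⟩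
  have hst : s = (p ^ ℓ1) ^ t := by
    rw [hs, ht, mul_assoc, Nat.mul_div_cancel_left _ two_pos, pow_mul]
  have hs2 : Fintype.card E = s ^ 2 := by
    rw [hE, hq, hs, ← pow_mul, ← pow_mul, Nat.div_mul_cancel hem]
  have hEr : Fintype.card E = ((p ^ ℓ1) ^ 2) ^ t := by
    rw [hs2, hst]
    ring
  have hqs : Fintype.card F < s := by
    refine lt_of_pow_lt_pow_left₀ 2 (Nat.zero_le s) ?_
    rw [← hs2, hE]
    exact Nat.pow_lt_pow_right hF1 (by omega)
  have hs5 : Fintype.card F = 2 → 5 ≤ s := by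
    intro h2
    have hm5 : 5 ≤ m := by
      have : ¬ m = 4 := fun h => hmq ⟨h, h2⟩
      omega
    have : 2 ^ 5 ≤ s ^ 2 := by
      rw [← hs2, hE, h2]
      exact Nat.pow_le_pow_right two_pos hm5
    nlinarith
  rw [← hs] at hcond
  have hs0 : 0 < s := by omega
  have hvalues : ∀ σ : ℤ, σ = (-1) ^ t * s → ∀ v : E, v ≠ 0 → ∃ δ : ℕ, δ ≤ 1 ∧
      (N : ℂ) * ∑ x ∈ D, traceChar p E (v * x) = J.card * (σ - 1) - σ * N * δ := by
    intro σ hσ v hv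
    obtain ⟨δ, hδ, h⟩ := sum_traceChar_eq hl1 rfl hEr hγ' hD0 hpow hv
    refine ⟨δ, hδ, ?_⟩
    have hσ' : (σ : ℂ) = (-1) ^ t * ((p ^ ℓ1 : ℕ) : ℂ) ^ t := by
      rw [hσ, hst]
      push_cast
      ring
    rw [← hσ'] at h
    have hn0 : ((Fintype.card E - 1 : ℕ) : ℂ) ≠ 0 := by exact_mod_cast hn.ne'
    have hcard' : (D.card : ℂ) * N = J.card * (Fintype.card E - 1 : ℕ) := by exact_mod_cast hcard
    refine mul_left_cancel₀ hn0 ?_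
    linear_combination N * h + (σ - 1) * hcard'
  have hDN : (D.card : ℤ) * N = J.card * ((s : ℤ) ^ 2 - 1) := by
    have h1 : ((Fintype.card E - 1 : ℕ) : ℤ) = (s : ℤ) ^ 2 - 1 := by
      rw [Nat.cast_sub Fintype.card_pos, hs2]
      push_cast
      ring
    rw [← h1]
    exact_mod_cast hcard
  have hsZ : (Fintype.card F : ℤ) < s := by exact_mod_cast hqs
  have hFZ : (1 : ℤ) < Fintype.card F := by exact_mod_cast hF1
  have huZ : (J.card : ℤ) < N := by exact_mod_cast huN
  have hu0 : (0 : ℤ) ≤ J.card := by positivity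
  have hsQ : (0 : ℚ) < s := by exact_mod_cast hs0
  have hs1Q : (0 : ℚ) < s - 1 := by
    have : (1 : ℚ) < s := by exact_mod_cast hF1.trans hqs
    linarith
  rw [← hD]
  rcases hcond with ⟨hodd_t, hne, hlt⟩ | ⟨heven_t, hlt⟩
  · have hne' : (J.card : ℤ) * (s + 1) ≠ s * N := by
      rw [ne_eq, eq_div_iff (by positivity)] at hne
      exact_mod_cast hne
    have hlt' : (N : ℤ) < J.card * (s + 1) := by
      rw [gt_iff_lt, div_lt_iff₀ (by positivity)] at hlt
      exact_mod_cast hlt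
    refine codewordMD_minimal_of_two_values (σ := -s) ?_ ?_ ?_ hD0 hsmul huN ?_
      (hvalues _ ?_) ?_ ?_ ?_ ?_
    · rw [hs2]
      push_cast
      ring
    · rwa [abs_neg, Nat.abs_cast]
    · intro h
      rw [abs_neg, Nat.abs_cast]
      exact_mod_cast hs5 h
    · linear_combination hDN
    · rw [hodd_t.neg_one_pow, neg_one_mul]
    · linarith
    · linarith
    · intro h
      exact hne' (by linarith)
    · have h1 : 0 < (J.card * (s + 1) : ℤ) * (s - Fintype.card F) :=
        mul_pos (by linarith) (by linarith)
      have h2 : 0 ≤ (Fintype.card F - 1 : ℤ) * s * N :=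
        mul_nonneg (mul_nonneg (by linarith) (by linarith)) (by linarith)
      intro h
      linarith
  · have hlt' : (Fintype.card F - 1 : ℤ) * s * N < J.card * ((s + Fintype.card F) * (s - 1)) := by
      rw [gt_iff_lt, div_lt_iff₀ (by positivity)] at hlt
      exact_mod_cast hlt
    have hpos : 0 < (J.card : ℤ) := by
      refine lt_of_le_of_ne hu0 fun h => ?_
      rw [← h, zero_mul] at hlt'
      refine hlt'.not_ge (mul_nonneg (mul_nonneg ?_ ?_) ?_) <;> linarith
    have hpos' : 0 < (J.card : ℤ) * (s - 1) := mul_pos hpos (by linarith)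
    refine codewordMD_minimal_of_two_values (σ := s) ?_ ?_ ?_ hD0 hsmul huN hDN
      (hvalues _ ?_) hpos'.ne' ?_ ?_ ?_
    · exact_mod_cast hs2
    · rwa [Nat.abs_cast]
    · intro h
      rw [Nat.abs_cast]
      exact_mod_cast hs5 h
    · rw [heven_t.neg_one_pow, one_mul]
    · linarith
    · nlinarith
    · intro h
      linarith
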